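/- Let F : ℝ^d → ℝ be a differentiable function that is μ-strongly convex and whose gradient is β-Lipschitz continuous (0 < μ ≤ β), and let x* be its (unique) minimizer. Let x₀ ∈ ℝ^d, let 0 < η < 2/β, and define x₁ := x₀ − η∇F(x₀) and λ := max(|1 − ημ|, |1 − ηβ|). Then λ < 1 and ‖x₁ − x*‖ ≤ λ‖x₀ − x*‖. -/

import Mathlib

open scoped RealInnerProductSpace Gradient

section GradientInequalities

variable {E : Type*} [NormedAddCommGroup E] [InnerProductSpace ℝ E]

/-- Quadratic upper and lower first-order bounds imply cocoercivity. -/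
theorem norm_sq_sub_le_of_first_order_bounds {h : E → ℝ} {g : E → E} {L : ℝ} (hL : 0 ≤ L)
    (lower : ∀ x y, h x + ⟪g x, y - x⟫ ≤ h y)
    (upper : ∀ x y, h y ≤ h x + ⟪g x, y - x⟫ + L / 2 * ‖y - x‖ ^ 2) (x y : E) :
    ‖g x - g y‖ ^ 2 ≤ L * ⟪g x - g y, x - y⟫ := by
  have key : ∀ x y (t : ℝ), h y + ⟪g y, x - y⟫ - h x
      ≤ -t * ‖g x - g y‖ ^ 2 + L / 2 * t ^ 2 * ‖g x - g y‖ ^ 2 := by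
    intro x y t
    have h1 := (lower y (x - t • (g x - g y))).trans (upper x (x - t • (g x - g y)))
    rw [show x - t • (g x - g y) - x = -(t • (g x - g y)) by abel,
      show x - t • (g x - g y) - y = (x - y) - t • (g x - g y) by abel, norm_neg, norm_smul,
      mul_pow, Real.norm_eq_abs, sq_abs, inner_neg_right, inner_sub_right, inner_smul_right,
      inner_smul_right] at h1
    have h2 : ‖g x - g y‖ ^ 2 = ⟪g x, g x - g y⟫ - ⟪g y, g x - g y⟫ := by
      rw [← inner_sub_left, real_inner_self_eq_norm_sq]
    linear_combination h1 + t * h2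
  have sum_key : ∀ t : ℝ, (2 * t - L * t ^ 2) * ‖g x - g y‖ ^ 2 ≤ ⟪g x - g y, x - y⟫ := by
    intro t
    have h1 := key x y t
    have h2 := key y x t
    rw [norm_sub_rev (g y) (g x), ← neg_sub x y, inner_neg_right] at h2
    rw [inner_sub_left]
    linarith
  rcases hL.eq_or_lt with rfl | hL
  · by_contra! hq
    rw [zero_mul] at hq
    have := sum_key ((⟪g x - g y, x - y⟫ + 1) / (2 * ‖g x - g y‖ ^ 2))
    rw [zero_mul, sub_zero, mul_div_assoc', mul_div_mul_left _ _ two_ne_zero,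
      div_mul_cancel₀ _ hq.ne'] at this
    linarith
  · have h1 := mul_le_mul_of_nonneg_left (sum_key L⁻¹) hL.le
    have h2 : L * ((2 * L⁻¹ - L * L⁻¹ ^ 2) * ‖g x - g y‖ ^ 2) = ‖g x - g y‖ ^ 2 := by
      field_simp
      ring
    linarith

variable [CompleteSpace E]

theorem HasGradientAt.hasDerivAt_comp_line {f : E → ℝ} {g x v : E} {t : ℝ}
    (hf : HasGradientAt f g (x + t • v)) :
    HasDerivAt (fun s : ℝ => f (x + s • v)) ⟪g, v⟫ t := by
  have hline : HasDerivAt (fun s : ℝ => x + s • v) v t := by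
    simpa using ((hasDerivAt_id t).smul_const v).const_add x
  have := hf.hasFDerivAt.comp_hasDerivAt t hline
  rwa [InnerProductSpace.toDual_apply_apply] at this

theorem HasGradientAt.sub_half_mul_norm_sq {f : E → ℝ} {g x : E} (hf : HasGradientAt f g x)
    (μ : ℝ) : HasGradientAt (fun y => f y - μ / 2 * ‖y‖ ^ 2) (g - μ • x) x := by
  rw [hasGradientAt_iff_hasFDerivAt] at hf ⊢
  refine (hf.sub ((hasStrictFDerivAt_norm_sq x).hasFDerivAt.const_mul (μ / 2))).congr_fderiv ?_
  ext v
  simp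
  ring

/-- A convex function lies above its tangent planes. -/
theorem ConvexOn.add_inner_le_of_hasGradientAt {f : E → ℝ} {g x : E}
    (hf : ConvexOn ℝ Set.univ f) (hg : HasGradientAt f g x) (y : E) :
    f x + ⟪g, y - x⟫ ≤ f y := by
  have hconv : ConvexOn ℝ Set.univ (fun t : ℝ => f (x + t • (y - x))) := by
    have := hf.comp_affineMap (AffineMap.lineMap (k := ℝ) x y)
    simpa [Function.comp_def, AffineMap.lineMap_apply, add_comm] using this
  have hd : HasDerivAt (fun t : ℝ => f (x + t • (y - x))) ⟪g, y - x⟫ 0 :=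
    HasGradientAt.hasDerivAt_comp_line (by simpa using hg)
  have := hconv.le_slope_of_hasDerivAt (Set.mem_univ 0) (Set.mem_univ 1) one_pos hd
  simp [slope_def_field] at this
  linarith

/-- The descent lemma for functions with Lipschitz gradient. -/
theorem le_add_inner_gradient_add_norm_sq {f : E → ℝ} {β : ℝ} (hf : Differentiable ℝ f)
    (hlip : ∀ x y, ‖∇ f x - ∇ f y‖ ≤ β * ‖x - y‖) (x y : E) :
    f y ≤ f x + ⟪∇ f x, y - x⟫ + β / 2 * ‖y - x‖ ^ 2 := by
  set v := y - x with hv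
  have hd : ∀ t : ℝ, HasDerivAt
      (fun s : ℝ => f (x + s • v) - s * ⟪∇ f x, v⟫ - β / 2 * ‖v‖ ^ 2 * s ^ 2)
      (⟪∇ f (x + t • v), v⟫ - ⟪∇ f x, v⟫ - β * ‖v‖ ^ 2 * t) t := by
    intro t
    refine (((hf (x + t • v)).hasGradientAt.hasDerivAt_comp_line.sub
      ((hasDerivAt_id t).mul_const ⟪∇ f x, v⟫)).sub
      ((hasDerivAt_pow 2 t).const_mul (β / 2 * ‖v‖ ^ 2))).congr_deriv ?_
    push_cast
    ring
  have hanti := antitoneOn_of_deriv_nonpos (convex_Icc (0 : ℝ) 1)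
    (fun t _ => (hd t).continuousAt.continuousWithinAt)
    (fun t _ => (hd t).differentiableAt.differentiableWithinAt) (by
      intro t ht
      rw [interior_Icc] at ht
      rw [(hd t).deriv, ← inner_sub_left]
      have h1 := real_inner_le_norm (∇ f (x + t • v) - ∇ f x) v
      have h2 := hlip (x + t • v) x
      rw [add_sub_cancel_left, norm_smul, Real.norm_of_nonneg ht.1.le] at h2
      have h3 := mul_le_mul_of_nonneg_right h2 (norm_nonneg v)
      linarith)
  have := hanti (Set.left_mem_Icc.2 zero_le_one) (Set.right_mem_Icc.2 zero_le_one) zero_le_one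
  simp [hv] at this ⊢
  linarith

/-- For a `μ`-strongly convex function with `β`-Lipschitz gradient, the gradient differs from
multiplication by `(μ + β) / 2` by a `(β - μ) / 2`-Lipschitz map. -/
theorem norm_gradient_sub_sub_smul_le {f : E → ℝ} {μ β : ℝ} (hμβ : μ ≤ β)
    (hf : Differentiable ℝ f)
    (hconv : ConvexOn ℝ Set.univ (fun x => f x - μ / 2 * ‖x‖ ^ 2))
    (hlip : ∀ x y, ‖∇ f x - ∇ f y‖ ≤ β * ‖x - y‖) (x y : E) :
    ‖(∇ f x - ∇ f y) - ((μ + β) / 2) • (x - y)‖ ≤ (β - μ) / 2 * ‖x - y‖ := by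
  have hco := norm_sq_sub_le_of_first_order_bounds (sub_nonneg.2 hμβ)
    (fun x y => hconv.add_inner_le_of_hasGradientAt
      ((hf x).hasGradientAt.sub_half_mul_norm_sq μ) y)
    (fun x y => by
      have h1 := le_add_inner_gradient_add_norm_sq hf hlip x y
      have h2 : ‖y‖ ^ 2 = ‖x‖ ^ 2 + 2 * ⟪x, y - x⟫ + ‖y - x‖ ^ 2 := by
        rw [← norm_add_sq_real, add_sub_cancel]
      rw [inner_sub_left, real_inner_smul_left]
      linear_combination h1 - μ / 2 * h2) x y
  rw [show ∇ f x - μ • x - (∇ f y - μ • y) = (∇ f x - ∇ f y) - μ • (x - y) by module] at hco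
  refine (sq_le_sq₀ (norm_nonneg _) (mul_nonneg (by linarith) (norm_nonneg _))).1 ?_
  rw [norm_sub_sq_real, inner_sub_left (_ - _), real_inner_smul_left,
    real_inner_self_eq_norm_sq, real_inner_smul_right, norm_smul, mul_pow, Real.norm_eq_abs, sq_abs] at hco
  rw [norm_sub_sq_real, real_inner_smul_right, norm_smul, mul_pow, mul_pow, Real.norm_eq_abs,
    sq_abs]
  linear_combination hco

end GradientInequalities


/-- Linear contraction of a gradient step for a strongly convex function
with Lipschitz gradient (Lemma 1 of the paper). -/
theorem gradient_step_contraction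
    (d : ℕ) (F : EuclideanSpace ℝ (Fin d) → ℝ) (μ β : ℝ)
    (hμ : 0 < μ) (hμβ : μ ≤ β)
    (hdiff : Differentiable ℝ F)
    (hstrong : ConvexOn ℝ Set.univ (fun x => F x - μ / 2 * ‖x‖ ^ 2))
    (hlip : ∀ x y : EuclideanSpace ℝ (Fin d),
      ‖gradient F x - gradient F y‖ ≤ β * ‖x - y‖)
    (xstar : EuclideanSpace ℝ (Fin d)) (hmin : ∀ z, F xstar ≤ F z)
    (x0 : EuclideanSpace ℝ (Fin d)) (η : ℝ) (hη0 : 0 < η) (hη2 : η < 2 / β) :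
    max |1 - η * μ| |1 - η * β| < 1 ∧
      ‖x0 - η • gradient F x0 - xstar‖ ≤ max |1 - η * μ| |1 - η * β| * ‖x0 - xstar‖ := by
  have hβ : 0 < β := hμ.trans_le hμβ
  have hηβ : η * β < 2 := (lt_div_iff₀ hβ).1 hη2
  have hημ : η * μ ≤ η * β := mul_le_mul_of_nonneg_left hμβ hη0.le
  have hημ0 : 0 < η * μ := mul_pos hη0 hμ
  refine ⟨max_lt (abs_lt.2 ⟨by linarith, by linarith⟩) (abs_lt.2 ⟨by linarith, by linarith⟩), ?_⟩
  have hstar : ∇ F xstar = 0 := by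
    have hloc : IsLocalMin F xstar := Filter.Eventually.of_forall hmin
    rw [gradient, hloc.fderiv_eq_zero, map_zero]
  have hcon := norm_gradient_sub_sub_smul_le hμβ hdiff hstrong hlip x0 xstar
  rw [hstar, sub_zero] at hcon
  have hrate : |1 - η * ((μ + β) / 2)| + η * ((β - μ) / 2)
      ≤ max |1 - η * μ| |1 - η * β| := by
    rcases abs_cases (1 - η * ((μ + β) / 2)) with h | h
    · refine le_max_of_le_left (le_trans ?_ (le_abs_self _))
      linarith
    · refine le_max_of_le_right (le_trans ?_ (neg_le_abs _))
      linarith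
  calc ‖x0 - η • ∇ F x0 - xstar‖
      = ‖(1 - η * ((μ + β) / 2)) • (x0 - xstar)
          - η • (∇ F x0 - ((μ + β) / 2) • (x0 - xstar))‖ := by
        congr 1
        module
    _ ≤ |1 - η * ((μ + β) / 2)| * ‖x0 - xstar‖ + η * ((β - μ) / 2 * ‖x0 - xstar‖) := by
        refine (norm_sub_le _ _).trans ?_
        rw [norm_smul, norm_smul, Real.norm_eq_abs, Real.norm_of_nonneg hη0.le]
        gcongr
    _ = (|1 - η * ((μ + β) / 2)| + η * ((β - μ) / 2)) * ‖x0 - xstar‖ := by ring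
    _ ≤ max |1 - η * μ| |1 - η * β| * ‖x0 - xstar‖ := by gcongr
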